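/- arXiv:2108.00314 — 2 statements merged into one kernel-verified Lean document; each statement's English description precedes it below -/
import Mathlib

section
/- Let T ≥ 1, n ≥ 1, X = ℝ^T with the ℓ2 (Euclidean) metric, and let R be the element-wise median rule. Then for every ε > 0, in every deliberation process the winner is invariant, w^j = w^0 for all j, and the process converges to the consensus w^0 after exactly max_i ⌈d(v_i^0, w^0)/ε⌉ iterations. -/
/-- A deliberation process: at each iteration `j`, every agent `i` moves from `V j i`
to `V (j+1) i`, subject to constraints (C1) and (C2) with respect to the current
winner `R (V j)` and step size `ε`. -/
def DelibProcess {X : Type*} {n : ℕ} (d : X → X → ℝ) (R : (Fin n → X) → X) (ε : ℝ)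
    (V : ℕ → Fin n → X) : Prop :=
  ∀ (i : Fin n) (j : ℕ),
    d (V (j + 1) i) (R (V j)) = max 0 (d (V j i) (R (V j)) - ε) ∧
    (0 < d (V (j + 1) i) (R (V j)) → d (V (j + 1) i) (V j i) = ε) ∧
    (d (V (j + 1) i) (R (V j)) = 0 → d (V (j + 1) i) (V j i) ≤ ε)

/-- The process converges: from some iteration on, the profile never changes. -/
def Converges {X : Type*} {n : ℕ} (V : ℕ → Fin n → X) : Prop :=
  ∃ N : ℕ, ∀ j : ℕ, N ≤ j → V j = V N
/-- The ℓ2 (Euclidean) distance on ℝ^T. -/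
noncomputable def ldist {T : ℕ} (x y : Fin T → ℝ) : ℝ :=
  Real.sqrt (∑ t : Fin T, (x t - y t) ^ 2)

/-- The median of n real numbers: the middle value in sorted (ascending) order, where
for an even number of values we take the larger of the two middle values; i.e., the
value at 0-indexed position ⌊n/2⌋ of the ascending sorted list. -/
noncomputable def medianVal {n : ℕ} (f : Fin n → ℝ) : ℝ :=
  ((Multiset.ofList (List.ofFn f)).sort (· ≤ ·)).getD (n / 2) 0

/-- The element-wise median rule on ℝ^T. -/
noncomputable def medianRule {T n : ℕ} (V : Fin n → Fin T → ℝ) : Fin T → ℝ :=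
  fun t => medianVal (fun i : Fin n => V i t)

theorem List.Pairwise.prop_getD_iff_lt_countP {α : Type*} [Preorder α] {p : α → Prop}
    [DecidablePred p] (hp : ∀ a b, a ≤ b → p b → p a) (d : α) :
    ∀ {l : List α} {k : ℕ}, l.Pairwise (· ≤ ·) → k < l.length →
      (p (l.getD k d) ↔ k < l.countP p)
  | [], k, _, hk => by simp at hk
  | a :: l, k, hl, hk => by
    rw [List.pairwise_cons] at hl
    by_cases ha : p a
    · cases k with
      | zero => simp [ha]
      | succ k =>
        have ih := prop_getD_iff_lt_countP hp d hl.2 (k := k) (by simpa using hk)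
        simpa [ha] using ih
    · have hnot : ∀ x ∈ a :: l, ¬ p x := by
        intro x hx hpx
        rcases List.mem_cons.1 hx with rfl | hx
        · exact ha hpx
        · exact ha (hp _ _ (hl.1 x hx) hpx)
      have hzero : (a :: l).countP p = 0 := by
        rw [List.countP_eq_zero]
        simpa using hnot
      rw [hzero, List.getD_eq_getElem _ _ hk]
      simpa only [Nat.not_lt_zero, iff_false] using hnot _ (List.getElem_mem hk)

/-- A downward closed predicate holds at the median iff it holds for more than `n / 2` of the
values. -/
theorem prop_medianVal_iff {n : ℕ} (hn : 1 ≤ n) (f : Fin n → ℝ) {p : ℝ → Prop}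
    [DecidablePred p] (hp : ∀ a b, a ≤ b → p b → p a) :
    p (medianVal f) ↔ n / 2 < (Finset.univ.filter fun i => p (f i)).card := by
  have hlen : n / 2 < ((Multiset.ofList (List.ofFn f)).sort (· ≤ ·)).length := by
    simp only [Multiset.length_sort, Multiset.coe_card, List.length_ofFn]
    omega
  have hcount : ((Multiset.ofList (List.ofFn f)).sort (· ≤ ·)).countP p =
      (Finset.univ.filter fun i => p (f i)).card := by
    rw [← Multiset.coe_countP, Multiset.sort_eq, ← Fin.univ_val_map, Multiset.countP_map]
    rfl
  rw [medianVal, List.Pairwise.prop_getD_iff_lt_countP hp 0 (Multiset.pairwise_sort _ _) hlen,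
    hcount]

/-- Moving values weakly towards the median, without crossing it, preserves the median. -/
theorem medianVal_eq_of_forall_le {n : ℕ} (hn : 1 ≤ n) {f g : Fin n → ℝ}
    (hle : ∀ i, f i ≤ medianVal f → g i ≤ medianVal f)
    (hge : ∀ i, medianVal f ≤ f i → medianVal f ≤ g i) :
    medianVal g = medianVal f := by
  apply le_antisymm
  · rw [prop_medianVal_iff hn g (p := (· ≤ medianVal f)) fun _ _ h h' => h.trans h']
    have h := (prop_medianVal_iff hn f (p := (· ≤ medianVal f))
      fun _ _ h h' => h.trans h').1 le_rfl
    exact h.trans_le (Finset.card_le_card (Finset.monotone_filter_right _ fun i _ => hle i))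
  · by_contra! hlt
    rw [prop_medianVal_iff hn g (p := (· < medianVal f)) fun _ _ h h' => h.trans_lt h'] at hlt
    have h := (prop_medianVal_iff hn f (p := (· < medianVal f))
      fun _ _ h h' => h.trans_lt h').2 (hlt.trans_le (Finset.card_le_card
        (Finset.monotone_filter_right _ fun i _ => by
          simpa only [not_le] using mt (hge i))))
    exact h.false

theorem ldist_eq_dist {T : ℕ} (x y : Fin T → ℝ) :
    ldist x y = dist (WithLp.toLp 2 x : EuclideanSpace ℝ (Fin T)) (WithLp.toLp 2 y) := by
  simp [ldist, EuclideanSpace.dist_eq, Real.dist_eq, sq_abs]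

theorem ldist_eq_zero_iff {T : ℕ} {x y : Fin T → ℝ} : ldist x y = 0 ↔ x = y := by
  rw [ldist_eq_dist, dist_eq_zero, (WithLp.toLp_injective 2).eq_iff]

/-- An agent moves along the segment from its current position to the winner. -/
theorem DelibProcess.wbtw {T n : ℕ} {R : (Fin n → Fin T → ℝ) → Fin T → ℝ} {ε : ℝ}
    {V : ℕ → Fin n → Fin T → ℝ} (hV : DelibProcess ldist R ε V) (j : ℕ) (i : Fin n) :
    Wbtw ℝ (V j i) (V (j + 1) i) (R (V j)) := by
  obtain ⟨hdist, hmove, -⟩ := hV i j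
  rcases le_or_gt (ldist (V j i) (R (V j)) - ε) 0 with h | h
  · rw [max_eq_left h, ldist_eq_zero_iff] at hdist
    rw [hdist]
    exact wbtw_self_right ℝ _ _
  · rw [max_eq_right h.le] at hdist
    have hstep := hmove (hdist ▸ h)
    simp only [ldist_eq_dist] at hdist hstep
    have hw := dist_add_dist_eq_iff.1 (show
      dist (WithLp.toLp 2 (V j i) : EuclideanSpace ℝ (Fin T)) (WithLp.toLp 2 (V (j + 1) i)) +
        dist (WithLp.toLp 2 (V (j + 1) i) : EuclideanSpace ℝ (Fin T))
          (WithLp.toLp 2 (R (V j))) =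
        dist (WithLp.toLp 2 (V j i) : EuclideanSpace ℝ (Fin T)) (WithLp.toLp 2 (R (V j))) by
      rw [dist_comm, hstep, hdist]
      ring)
    exact hw.map (WithLp.linearEquiv 2 ℝ (Fin T → ℝ)).toLinearMap.toAffineMap

theorem DelibProcess.medianRule_eq {T n : ℕ} (hn : 1 ≤ n) {ε : ℝ} {V : ℕ → Fin n → Fin T → ℝ}
    (hV : DelibProcess ldist medianRule ε V) (j : ℕ) :
    medianRule (V j) = medianRule (V 0) := by
  induction j with
  | zero => rfl
  | succ j ih =>
    rw [← ih]
    funext t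
    have hw (i : Fin n) : Wbtw ℝ (V j i t) (V (j + 1) i t) (medianRule (V j) t) :=
      (hV.wbtw j i).map (LinearMap.proj (R := ℝ) (φ := fun _ => ℝ) t).toAffineMap
    refine medianVal_eq_of_forall_le hn (fun i hi => ?_) fun i hi => ?_
    · exact ((segment_eq_Icc hi).subset (hw i).mem_segment).2
    · exact ((segment_eq_Icc hi).subset (hw i).symm.mem_segment).1

theorem DelibProcess.dist_eq_of_invariant {X : Type*} {n : ℕ} {d : X → X → ℝ}
    {R : (Fin n → X) → X} {ε : ℝ} (hε : 0 ≤ ε) {V : ℕ → Fin n → X}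
    (hV : DelibProcess d R ε V) (hd : ∀ x y, 0 ≤ d x y) (hR : ∀ j, R (V j) = R (V 0))
    (j : ℕ) (i : Fin n) :
    d (V j i) (R (V 0)) = max 0 (d (V 0 i) (R (V 0)) - j * ε) := by
  induction j with
  | zero => simp [hd]
  | succ j ih =>
    have h := (hV i j).1
    rw [hR j, ih] at h
    rw [h]
    push_cast
    rcases le_total (d (V 0 i) (R (V 0)) - j * ε) 0 with h0 | h0
    · rw [max_eq_left h0, max_eq_left (by linarith), max_eq_left (by linarith)]
    · rw [max_eq_right h0, add_one_mul, sub_sub]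

theorem DelibProcess.eq_medianRule_iff {T n : ℕ} (hn : 1 ≤ n) {ε : ℝ} (hε : 0 < ε)
    {V : ℕ → Fin n → Fin T → ℝ} (hV : DelibProcess ldist medianRule ε V) (j : ℕ) (i : Fin n) :
    V j i = medianRule (V 0) ↔ ⌈ldist (V 0 i) (medianRule (V 0)) / ε⌉₊ ≤ j := by
  rw [← ldist_eq_zero_iff,
    hV.dist_eq_of_invariant hε.le (fun _ _ => Real.sqrt_nonneg _) (hV.medianRule_eq hn),
    max_eq_left_iff, sub_nonpos, Nat.ceil_le, div_le_iff₀ hε]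

/-- On ℝ^T with the ℓ2 metric and the element-wise median rule: in every deliberation
process the winner is invariant, and the process converges to the consensus w^0 after
exactly max_i ⌈d(v_i^0, w^0)/ε⌉ iterations. -/
theorem stmt11 {T n : ℕ} (hT : 1 ≤ T) (hn : 1 ≤ n) {ε : ℝ} (hε : 0 < ε)
    (V : ℕ → Fin n → (Fin T → ℝ)) (hV : DelibProcess ldist medianRule ε V) :
    (∀ j : ℕ, medianRule (V j) = medianRule (V 0)) ∧
    (∀ j : ℕ,
      (Finset.univ.sup fun i : Fin n => ⌈ldist (V 0 i) (medianRule (V 0)) / ε⌉₊) ≤ j →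
      ∀ i : Fin n, V j i = medianRule (V 0)) ∧
    (∀ j : ℕ,
      j < (Finset.univ.sup fun i : Fin n => ⌈ldist (V 0 i) (medianRule (V 0)) / ε⌉₊) →
      ∃ i : Fin n, V j i ≠ medianRule (V 0)) ∧
    Converges V := by
  have hiff := hV.eq_medianRule_iff hn hε
  have hconv (j : ℕ)
      (hj : (Finset.univ.sup fun i : Fin n => ⌈ldist (V 0 i) (medianRule (V 0)) / ε⌉₊) ≤ j)
      (i : Fin n) : V j i = medianRule (V 0) :=
    (hiff j i).2 (Finset.sup_le_iff.1 hj i (Finset.mem_univ i))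
  refine ⟨hV.medianRule_eq hn, hconv, fun j hj => ?_,
    Finset.univ.sup fun i : Fin n => ⌈ldist (V 0 i) (medianRule (V 0)) / ε⌉₊, fun j hj => ?_⟩
  · obtain ⟨i, -, hi⟩ := Finset.lt_sup_iff.1 hj
    exact ⟨i, fun h => ((hiff j i).1 h).not_gt hi⟩
  · funext i
    rw [hconv j hj i, hconv _ le_rfl i]
end

section
/- Convergence is not guaranteed for X = ℝ^3 with the ℓ∞ metric and the element-wise mean rule. Concretely, with n = 3 agents and ε = 1, define for every j ∈ ℕ: v_0^j = (−4+j, 2+j, 2+j), v_1^j = (2+j, −4+j, 2+j), v_2^j = (2+j, 2+j, −4+j). Then the winner at every iteration is w^j = (j, j, j); the sequences satisfy the deliberation constraints (C1) and (C2) (each agent's ℓ∞ distance to w^j drops from 4 to 3, and each agent moves ℓ∞ distance exactly 1); and the process never converges, since v_i^{j+1} ≠ v_i^j for every agent i and every j. -/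
/-- The ℓ∞ distance on ℝ^3. -/
def linfdist (x y : Fin 3 → ℝ) : ℝ :=
  max |x 0 - y 0| (max |x 1 - y 1| |x 2 - y 2|)

/-- The element-wise mean rule on ℝ^3 for 3 agents. -/
noncomputable def meanRule (V : Fin 3 → Fin 3 → ℝ) : Fin 3 → ℝ :=
  fun t => (∑ i : Fin 3, V i t) / 3

/-- Non-convergence for ℝ^3 with the ℓ∞ metric and the element-wise mean rule:
with 3 agents and ε = 1, the explicitly given trajectories have winner (j,j,j) at
every iteration j, each agent is at ℓ∞ distance 4 from the current winner, the
deliberation constraints (C1) and (C2) hold, every agent moves at every iteration,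
and the process never converges. -/
theorem stmt12 (V : ℕ → Fin 3 → (Fin 3 → ℝ))
    (hV : ∀ j : ℕ, V j =
      ![![(-4 : ℝ) + j, 2 + j, 2 + j],
        ![(2 : ℝ) + j, -4 + j, 2 + j],
        ![(2 : ℝ) + j, 2 + j, -4 + j]]) :
    (∀ j : ℕ, meanRule (V j) = fun _ => (j : ℝ)) ∧
    (∀ (i : Fin 3) (j : ℕ), linfdist (V j i) (meanRule (V j)) = 4) ∧
    DelibProcess linfdist meanRule 1 V ∧
    (∀ (i : Fin 3) (j : ℕ), V (j + 1) i ≠ V j i) ∧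
    ¬ Converges V := by
  have mean_eq : ∀ j : ℕ, meanRule (V j) = fun _ => (j : ℝ) := by
    intro j
    funext t
    fin_cases t <;> simp [meanRule, hV, Fin.sum_univ_three] <;> ring
  have dist_winner : ∀ (i : Fin 3) (j : ℕ), linfdist (V j i) (meanRule (V j)) = 4 := by
    intro i j
    rw [mean_eq, hV]
    fin_cases i <;> simp [linfdist] <;> norm_num
  have dist_winner_succ :
      ∀ (i : Fin 3) (j : ℕ), linfdist (V (j + 1) i) (meanRule (V j)) = 3 := by
    intro i j
    have neg_coord : (-4 : ℝ) + (j + 1) - j = -3 := by ring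
    have pos_coord : (2 : ℝ) + (j + 1) - j = 3 := by ring
    rw [mean_eq, hV]
    fin_cases i <;> simp [linfdist, neg_coord, pos_coord]
  have dist_step : ∀ (i : Fin 3) (j : ℕ), linfdist (V (j + 1) i) (V j i) = 1 := by
    intro i j
    rw [hV, hV]
    fin_cases i <;> simp [linfdist]
  have moves : ∀ (i : Fin 3) (j : ℕ), V (j + 1) i ≠ V j i := by
    intro i j h
    have hd := dist_step i j
    rw [h] at hd
    simp [linfdist] at hd
  refine ⟨mean_eq, dist_winner, fun i j => ⟨?_, fun _ => dist_step i j,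
    fun _ => (dist_step i j).le⟩, moves, ?_⟩
  · rw [dist_winner_succ, dist_winner]
    norm_num
  · rintro ⟨N, hN⟩
    exact moves 0 N (congrFun (hN (N + 1) N.le_succ) 0)
end
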